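/- Let n ≥ 11, let W be a four-linear form on ℝⁿ with the symmetries of a Weyl tensor, and for a, b ∈ {1,…,n} let L⁰_{ab}(x) = −(1/(3n)) (∑_{p,q=1}^n W_{apbq} x_p x_q) (1 + |x|²/(n(n−2)))^{−n/2}. Then for all a, b, c, d ∈ {1,…,n}: ∫_{ℝⁿ} ⟨∇L⁰_{ab}(x), ∇L⁰_{cd}(x)⟩ dx = ((n+4)/(36(n+1))) · (∫_{ℝⁿ}(1 + |x|²/(n(n−2)))^{−n} dx) · ∑_{p,q=1}^n W_{apbq} (W_{cpdq} + W_{cqdp}). -/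

import Mathlib

open MeasureTheory Real
open scoped RealInnerProductSpace

noncomputable section

/-- The Euclidean space `ℝⁿ`. -/
abbrev En (n : ℕ) := EuclideanSpace ℝ (Fin n)

/-- `W` has the symmetries of a Weyl tensor. -/
def IsWeyl (n : ℕ) (W : Fin n → Fin n → Fin n → Fin n → ℝ) : Prop :=
  (∀ i j k l, W i j k l = -W j i k l) ∧
  (∀ i j k l, W i j k l = -W i j l k) ∧
  (∀ i j k l, W i j k l = W k l i j) ∧
  (∀ j l, ∑ i, W i j i l = 0) ∧
  (∀ i j k l, W i j k l + W j k i l + W k i j l = 0)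

/-- `L⁰_{ab}(x) = -(1/(3n)) (∑_{p,q} W_{apbq} x_p x_q)(1 + |x|²/(n(n-2)))^{-n/2}`. -/
noncomputable def L0 (n : ℕ) (W : Fin n → Fin n → Fin n → Fin n → ℝ)
    (a b : Fin n) (x : En n) : ℝ :=
  -(1 / (3 * (n : ℝ))) * (∑ p, ∑ q, W a p b q * x p * x q) *
    (1 + ‖x‖ ^ 2 / ((n : ℝ) * ((n : ℝ) - 2))) ^ (-((n : ℝ) / 2))

/-- `bubblePow n m x = (1 + |x|²/(n(n-2)))^{-m}`. -/
def bubblePow (n : ℕ) (m : ℝ) (x : En n) : ℝ :=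
  (1 + ‖x‖ ^ 2 / ((n : ℝ) * ((n : ℝ) - 2))) ^ (-m)

section BubblePow

variable {n : ℕ}

lemma scale_pos (hn : 3 ≤ n) : 0 < (n : ℝ) * ((n : ℝ) - 2) := by
  have : (3 : ℝ) ≤ n := by exact_mod_cast hn
  exact mul_pos (by linarith) (by linarith)

lemma bubbleBase_pos (hn : 3 ≤ n) (x : En n) :
    0 < 1 + ‖x‖ ^ 2 / ((n : ℝ) * ((n : ℝ) - 2)) := by
  have := scale_pos hn
  positivity

lemma bubblePow_mul (hn : 3 ≤ n) (m m' : ℝ) (x : En n) :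
    bubblePow n m x * bubblePow n m' x = bubblePow n (m + m') x := by
  rw [bubblePow, bubblePow, bubblePow, ← Real.rpow_add (bubbleBase_pos hn x)]
  congr 1
  ring

lemma normSq_mul_bubblePow (hn : 3 ≤ n) (m : ℝ) (x : En n) :
    ‖x‖ ^ 2 * bubblePow n (m + 1) x =
      (n : ℝ) * ((n : ℝ) - 2) * (bubblePow n m x - bubblePow n (m + 1) x) := by
  have h0 := (scale_pos hn).ne'
  have h : bubblePow n m x =
      bubblePow n (m + 1) x * (1 + ‖x‖ ^ 2 / ((n : ℝ) * ((n : ℝ) - 2))) := by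
    rw [bubblePow, bubblePow, ← Real.rpow_add_one (bubbleBase_pos hn x).ne']
    congr 1
    ring
  rw [h]
  generalize (n : ℝ) * ((n : ℝ) - 2) = s at *
  field_simp
  ring

lemma differentiable_bubblePow (hn : 3 ≤ n) (m : ℝ) : Differentiable ℝ (bubblePow n m) := by
  intro x
  unfold bubblePow
  refine DifferentiableAt.rpow_const ?_ (Or.inl (bubbleBase_pos hn x).ne')
  have h : DifferentiableAt ℝ (fun y : En n => ‖y‖ ^ 2) x := differentiableAt_id.norm_sq ℝ
  fun_prop

lemma HasLineDerivAt.fun_mul {f g : En n → ℝ} {f' g' : ℝ} {x v : En n}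
    (hf : HasLineDerivAt ℝ f f' x v) (hg : HasLineDerivAt ℝ g g' x v) :
    HasLineDerivAt ℝ (fun y => f y * g y) (f' * g x + f x * g') x v := by
  have h := HasDerivAt.fun_mul (𝕜 := ℝ) hf hg
  simp only [zero_smul, add_zero] at h
  exact h

lemma hasLineDerivAt_coord (p i : Fin n) (x : En n) :
    HasLineDerivAt ℝ (fun y : En n => y p) (if p = i then 1 else 0) x
      (EuclideanSpace.single i 1) := by
  have h := ((EuclideanSpace.proj p : En n →L[ℝ] ℝ).hasFDerivAt (x := x)).hasLineDerivAt
    (EuclideanSpace.single i 1)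
  simpa [Pi.single_apply] using h

lemma hasLineDerivAt_bubblePow (hn : 3 ≤ n) (m : ℝ) (i : Fin n) (x : En n) :
    HasLineDerivAt ℝ (bubblePow n m)
      (-(2 * m / ((n : ℝ) * ((n : ℝ) - 2))) * (x i * bubblePow n (m + 1) x)) x
      (EuclideanSpace.single i 1) := by
  have h1 : HasFDerivAt (fun y : En n => ‖y‖ ^ 2) (2 • (innerSL ℝ x)) x :=
    (hasStrictFDerivAt_norm_sq x).hasFDerivAt
  have h2 := (((h1.hasLineDerivAt (EuclideanSpace.single i 1)).div_const
    ((n : ℝ) * ((n : ℝ) - 2))).const_add 1).rpow_const (p := -m)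
    (Or.inl (by simpa using (bubbleBase_pos hn x).ne'))
  have h3 : -(2 * m / ((n : ℝ) * ((n : ℝ) - 2))) * (x i * bubblePow n (m + 1) x) =
      (2 • innerSL ℝ x) (EuclideanSpace.single i 1) / ((n : ℝ) * ((n : ℝ) - 2)) * -m *
        (1 + ‖x + (0 : ℝ) • EuclideanSpace.single i 1‖ ^ 2 / ((n : ℝ) * ((n : ℝ) - 2))) ^
          (-m - 1) := by
    rw [bubblePow, neg_add, ← sub_eq_add_neg]
    simp [EuclideanSpace.inner_single_right]
    ring
  rw [h3]
  exact h2

lemma integrable_mul_bubblePow (hn : 3 ≤ n) {P : En n → ℝ} (hP : Continuous P) (j : ℕ)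
    (hPj : ∀ x, |P x| ≤ ‖x‖ ^ j) (m : ℝ) (hm : n + j < 2 * m) :
    Integrable (fun x => P x * bubblePow n m x) := by
  have hs := scale_pos hn
  have hs1 : 1 ≤ (n : ℝ) * ((n : ℝ) - 2) := by
    have : (3 : ℝ) ≤ n := by exact_mod_cast hn
    nlinarith
  have hint := integrable_rpow_neg_one_add_norm_sq (E := En n) (μ := volume)
    (r := 2 * m - j) (by simp; linarith)
  refine (hint.const_mul (((n : ℝ) * ((n : ℝ) - 2)) ^ m)).mono'
    (hP.mul (differentiable_bubblePow hn m).continuous).aestronglyMeasurable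
    (Filter.Eventually.of_forall fun x => ?_)
  have hm0 : 0 ≤ m := by
    have : (0 : ℝ) ≤ n + j := by positivity
    linarith
  have hpos : (0 : ℝ) < 1 + ‖x‖ ^ 2 := by positivity
  have hb : 0 ≤ bubblePow n m x := Real.rpow_nonneg (bubbleBase_pos hn x).le _
  rw [Real.norm_eq_abs, abs_mul, abs_of_nonneg hb]
  have h1 : |P x| ≤ (1 + ‖x‖ ^ 2) ^ ((j : ℝ) / 2) := by
    refine (hPj x).trans ?_
    rw [show (j : ℝ) / 2 = (1 / 2) * j by ring, Real.rpow_mul hpos.le, Real.rpow_natCast,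
      ← Real.sqrt_eq_rpow]
    gcongr
    exact Real.le_sqrt_of_sq_le (by linarith)
  have h2 : bubblePow n m x ≤
      ((n : ℝ) * ((n : ℝ) - 2)) ^ m * (1 + ‖x‖ ^ 2) ^ (-m) := by
    rw [show ((n : ℝ) * ((n : ℝ) - 2)) ^ m = (((n : ℝ) * ((n : ℝ) - 2))⁻¹) ^ (-m) by
      rw [Real.inv_rpow hs.le, Real.rpow_neg hs.le, inv_inv],
      ← Real.mul_rpow (by positivity) hpos.le]
    refine Real.rpow_le_rpow_of_nonpos (by positivity) ?_ (by linarith)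
    rw [mul_add, div_eq_inv_mul]
    have : ((n : ℝ) * ((n : ℝ) - 2))⁻¹ ≤ 1 := inv_le_one_of_one_le₀ hs1
    linarith
  calc |P x| * bubblePow n m x
      ≤ (1 + ‖x‖ ^ 2) ^ ((j : ℝ) / 2) *
        (((n : ℝ) * ((n : ℝ) - 2)) ^ m * (1 + ‖x‖ ^ 2) ^ (-m)) := by gcongr
    _ = ((n : ℝ) * ((n : ℝ) - 2)) ^ m * (1 + ‖x‖ ^ 2) ^ (-(2 * m - j) / 2) := by
      rw [mul_left_comm, ← Real.rpow_add hpos]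
      congr 2
      ring

/-- Integration by parts against a power of the bubble. -/
lemma integral_mul_coord_mul_bubblePow (hn : 3 ≤ n) {P P' : En n → ℝ} (i : Fin n) (j : ℕ)
    (hP : Continuous P) (hPj : ∀ x, |P x| ≤ ‖x‖ ^ j)
    (hP' : ∀ x, HasLineDerivAt ℝ P (P' x) x (EuclideanSpace.single i 1)) (m : ℝ)
    (hP'm : Integrable (fun x => P' x * bubblePow n m x)) (hm : n + j < 2 * m) :
    2 * m * ∫ x, x i * P x * bubblePow n (m + 1) x =
      (n : ℝ) * ((n : ℝ) - 2) * ∫ x, P' x * bubblePow n m x := by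
  have hs := (scale_pos hn).ne'
  have hi : Integrable (fun x : En n => x i * P x * bubblePow n (m + 1) x) := by
    refine integrable_mul_bubblePow hn (by fun_prop) (j + 1) (fun x => ?_) _ (by push_cast; linarith)
    rw [abs_mul, pow_succ, mul_comm]
    gcongr
    · exact hPj x
    · exact PiLp.norm_apply_le x i
  have h := integral_bilinear_hasLineDerivAt_right_eq_neg_left_of_integrable
    (μ := (volume : Measure (En n))) (v := EuclideanSpace.single i 1)
    (f := P) (f' := P') (g := bubblePow n m)
    (g' := fun x => -(2 * m / ((n : ℝ) * ((n : ℝ) - 2))) * (x i * bubblePow n (m + 1) x))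
    (B := ContinuousLinearMap.mul ℝ ℝ) (by simpa using hP'm)
    (by
      refine (hi.const_mul (-(2 * m / ((n : ℝ) * ((n : ℝ) - 2))))).congr
        (Filter.Eventually.of_forall fun x => ?_)
      simp only [ContinuousLinearMap.mul_apply']
      ring)
    (by simpa using integrable_mul_bubblePow hn hP j hPj m hm)
    (fun x _ => hP' x) (fun x _ => hasLineDerivAt_bubblePow hn m i x)
  simp only [ContinuousLinearMap.mul_apply'] at h
  have h3 : ∫ x : En n, P x * (-(2 * m / ((n : ℝ) * ((n : ℝ) - 2))) *
      (x i * bubblePow n (m + 1) x)) = -(2 * m / ((n : ℝ) * ((n : ℝ) - 2))) *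
        ∫ x : En n, x i * P x * bubblePow n (m + 1) x := by
    rw [← integral_const_mul]
    congr with x
    ring
  rw [h3] at h
  generalize (n : ℝ) * ((n : ℝ) - 2) = s at *
  field_simp at h
  linarith

lemma integrable_bubblePow (hn : 3 ≤ n) (m : ℝ) (hm : n < 2 * m) :
    Integrable (bubblePow n m) := by
  simpa using integrable_mul_bubblePow (P := fun _ => 1) hn continuous_const 0 (by simp) m
    (by simpa using hm)

lemma abs_coord_mul_le {P : En n → ℝ} {j : ℕ} (hP : ∀ x, |P x| ≤ ‖x‖ ^ j) (p : Fin n) (x : En n) :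
    |x p * P x| ≤ ‖x‖ ^ (j + 1) := by
  rw [abs_mul, pow_succ, mul_comm]
  gcongr
  · exact hP x
  · exact PiLp.norm_apply_le x p

lemma integrable_coord_mul_coord_mul_bubblePow (hn : 3 ≤ n) (p q : Fin n) (m : ℝ)
    (hm : n + 2 < 2 * m) : Integrable (fun x : En n => x p * x q * bubblePow n m x) :=
  integrable_mul_bubblePow hn (by fun_prop) 2
    (abs_coord_mul_le (j := 1) (fun x => by simpa using PiLp.norm_apply_le x q) p) m
    (by simpa using hm)

lemma integrable_quartic_mul_bubblePow (hn : 3 ≤ n) (p q r t : Fin n) (m : ℝ)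
    (hm : n + 4 < 2 * m) :
    Integrable (fun x : En n => x p * (x q * (x r * x t)) * bubblePow n m x) :=
  integrable_mul_bubblePow hn (by fun_prop) 4
    (abs_coord_mul_le (j := 3) (abs_coord_mul_le (j := 2) (abs_coord_mul_le (j := 1)
      (fun x => by simpa using PiLp.norm_apply_le x t) r) q) p) m
    (by simpa using hm)

lemma integral_coord_mul_coord_mul_bubblePow (hn : 3 ≤ n) (p q : Fin n) (m : ℝ)
    (hm : n + 1 < 2 * m) :
    2 * m * ∫ x : En n, x p * x q * bubblePow n (m + 1) x =
      (n : ℝ) * ((n : ℝ) - 2) * ((if q = p then 1 else 0) * ∫ x : En n, bubblePow n m x) := by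
  rw [integral_mul_coord_mul_bubblePow hn p 1 (by fun_prop)
    (fun x => by simpa using PiLp.norm_apply_le x q) (fun x => hasLineDerivAt_coord q p x) m
    ((integrable_bubblePow hn m (by linarith)).const_mul _) (by simpa using hm),
    integral_const_mul]

lemma integral_quartic_mul_bubblePow (hn : 3 ≤ n) (p q r t : Fin n) (m : ℝ)
    (hm : n + 3 < 2 * m) :
    2 * m * ∫ x : En n, x p * (x q * (x r * x t)) * bubblePow n (m + 1) x =
      (n : ℝ) * ((n : ℝ) - 2) *
        ((if q = p then 1 else 0) * (∫ x : En n, x r * x t * bubblePow n m x) +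
        (if r = p then 1 else 0) * (∫ x : En n, x q * x t * bubblePow n m x) +
        (if t = p then 1 else 0) * (∫ x : En n, x q * x r * bubblePow n m x)) := by
  have hi := fun p q : Fin n =>
    integrable_coord_mul_coord_mul_bubblePow hn p q m (by linarith)
  have heq : ∀ x : En n, ((if q = p then 1 else 0) * (x r * x t) +
      x q * ((if r = p then 1 else 0) * x t + x r * (if t = p then 1 else 0))) *
        bubblePow n m x =
      (if q = p then 1 else 0) * (x r * x t * bubblePow n m x) +
      (if r = p then 1 else 0) * (x q * x t * bubblePow n m x) +
      (if t = p then 1 else 0) * (x q * x r * bubblePow n m x) := fun x => by ring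
  have hi1 := (hi r t).const_mul (if q = p then 1 else 0)
  have hi2 := (hi q t).const_mul (if r = p then 1 else 0)
  have hi3 := (hi q r).const_mul (if t = p then 1 else 0)
  rw [integral_mul_coord_mul_bubblePow hn p 3 (by fun_prop)
    (abs_coord_mul_le (j := 2) (abs_coord_mul_le (j := 1)
      (fun x => by simpa using PiLp.norm_apply_le x t) r) q)
    (P' := fun x => (if q = p then 1 else 0) * (x r * x t) +
      x q * ((if r = p then 1 else 0) * x t + x r * (if t = p then 1 else 0)))
    (fun x => (hasLineDerivAt_coord q p x).fun_mul
      ((hasLineDerivAt_coord r p x).fun_mul (hasLineDerivAt_coord t p x))) m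
    (by simp_rw [heq]; exact (hi1.add hi2).add hi3) (by simpa using hm)]
  simp_rw [heq]
  rw [integral_add (hi1.fun_add hi2) hi3, integral_add hi1 hi2, integral_const_mul,
    integral_const_mul, integral_const_mul]

lemma integral_bubblePow_sub_one (hn : 4 ≤ n) :
    ((n : ℝ) - 2) * ∫ x : En n, bubblePow n (n - 1) x =
      2 * ((n : ℝ) - 1) * ∫ x : En n, bubblePow n n x := by
  have hn3 : 3 ≤ n := by omega
  have hn' : (4 : ℝ) ≤ n := by exact_mod_cast hn
  have hs := (scale_pos hn3).ne'
  have h1 : ∑ p : Fin n, 2 * ((n : ℝ) - 1) * ∫ x : En n, x p * x p * bubblePow n n x =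
      ∑ p : Fin n, (n : ℝ) * ((n : ℝ) - 2) * ∫ x : En n, bubblePow n (n - 1) x := by
    refine Finset.sum_congr rfl fun p _ => ?_
    simpa using integral_coord_mul_coord_mul_bubblePow hn3 p p (n - 1) (by linarith)
  have h2 : ∑ p : Fin n, ∫ x : En n, x p * x p * bubblePow n n x =
      (n : ℝ) * ((n : ℝ) - 2) *
        ((∫ x : En n, bubblePow n (n - 1) x) - ∫ x : En n, bubblePow n n x) := by
    rw [← integral_finsetSum _ fun p _ =>
      integrable_coord_mul_coord_mul_bubblePow hn3 p p n (by linarith),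
      ← integral_sub (integrable_bubblePow hn3 _ (by linarith))
        (integrable_bubblePow hn3 _ (by linarith)), ← integral_const_mul]
    congr with x
    have := normSq_mul_bubblePow hn3 (n - 1) x
    rw [sub_add_cancel] at this
    rw [← this, ← Finset.sum_mul, EuclideanSpace.real_norm_sq_eq]
    simp [sq]
  rw [← Finset.mul_sum, h2] at h1
  simp only [Finset.sum_const, Finset.card_univ, Fintype.card_fin, nsmul_eq_mul] at h1
  apply mul_left_cancel₀ hs
  linear_combination h1

lemma integral_coord_mul_coord_mul_bubblePow_dim (hn : 4 ≤ n) (p q : Fin n) :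
    ∫ x : En n, x p * x q * bubblePow n n x =
      (if q = p then 1 else 0) * (n * ∫ x : En n, bubblePow n n x) := by
  have hn' : (4 : ℝ) ≤ n := by exact_mod_cast hn
  have h := integral_coord_mul_coord_mul_bubblePow (by omega) p q (n - 1) (by linarith)
  rw [sub_add_cancel] at h
  have h1 := integral_bubblePow_sub_one hn
  have : (2 : ℝ) * (n - 1) ≠ 0 := by nlinarith
  apply mul_left_cancel₀ this
  linear_combination h + (if q = p then 1 else 0) * (n : ℝ) * h1

lemma integral_quartic_mul_bubblePow_dim_add_one (hn : 4 ≤ n) (p q r t : Fin n) :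
    ∫ x : En n, x p * (x q * (x r * x t)) * bubblePow n (n + 1) x =
      n * ((n : ℝ) - 2) / 2 * (∫ x : En n, bubblePow n n x) *
        ((if q = p then 1 else 0) * (if t = r then 1 else 0) +
          (if r = p then 1 else 0) * (if t = q then 1 else 0) +
          (if t = p then 1 else 0) * (if r = q then 1 else 0)) := by
  have hn' : (4 : ℝ) ≤ n := by exact_mod_cast hn
  have h := integral_quartic_mul_bubblePow (by omega) p q r t n (by linarith)
  simp only [integral_coord_mul_coord_mul_bubblePow_dim hn] at h
  have : (2 : ℝ) * n ≠ 0 := by positivity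
  apply mul_left_cancel₀ this
  linear_combination h

lemma integral_quartic_mul_bubblePow_dim_add_two (hn : 4 ≤ n) (p q r t : Fin n) :
    ∫ x : En n, x p * (x q * (x r * x t)) * bubblePow n (n + 2) x =
      n * ((n : ℝ) - 2) ^ 2 / (4 * (n + 1)) * (∫ x : En n, bubblePow n n x) *
        ((if q = p then 1 else 0) * (if t = r then 1 else 0) +
          (if r = p then 1 else 0) * (if t = q then 1 else 0) +
          (if t = p then 1 else 0) * (if r = q then 1 else 0)) := by
  have hn' : (4 : ℝ) ≤ n := by exact_mod_cast hn
  have h2 : ∀ p q : Fin n, ∫ x : En n, x p * x q * bubblePow n (n + 1) x =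
      ((n : ℝ) - 2) / 2 * ((if q = p then 1 else 0) * ∫ x : En n, bubblePow n n x) := by
    intro p q
    have h := integral_coord_mul_coord_mul_bubblePow (by omega) p q n (by linarith)
    have : (2 : ℝ) * n ≠ 0 := by positivity
    apply mul_left_cancel₀ this
    linear_combination h
  have h := integral_quartic_mul_bubblePow (by omega) p q r t (n + 1) (by linarith)
  rw [show (n : ℝ) + 1 + 1 = n + 2 by ring] at h
  simp only [h2] at h
  have : (2 : ℝ) * (n + 1) ≠ 0 := by positivity
  apply mul_left_cancel₀ this
  rw [h]
  field_simp
  ring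

/-- The quadratic form `∑_{p,q} A_{pq} x_p x_q`. -/
def quadForm (A : Fin n → Fin n → ℝ) (x : En n) : ℝ := ∑ p, ∑ q, A p q * x p * x q

/-- The `i`-th partial derivative of `quadForm A`. -/
def quadFormDeriv (A : Fin n → Fin n → ℝ) (i : Fin n) (x : En n) : ℝ :=
  ∑ q, (A i q + A q i) * x q

lemma hasLineDerivAt_quadForm (A : Fin n → Fin n → ℝ) (i : Fin n) (x : En n) :
    HasLineDerivAt ℝ (quadForm A) (quadFormDeriv A i x) x (EuclideanSpace.single i 1) := by
  have h : HasLineDerivAt ℝ (quadForm A) (∑ p, ∑ q, (A p q * (if p = i then 1 else 0) * x q +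
      A p q * x p * (if q = i then 1 else 0))) x (EuclideanSpace.single i 1) := by
    unfold HasLineDerivAt quadForm
    refine HasDerivAt.fun_sum fun p _ => HasDerivAt.fun_sum fun q _ => ?_
    have h : HasLineDerivAt ℝ (fun y : En n => A p q * y p) (A p q * (if p = i then 1 else 0)) x
        (EuclideanSpace.single i 1) := HasDerivAt.const_mul _ (hasLineDerivAt_coord p i x)
    exact h.fun_mul (hasLineDerivAt_coord q i x)
  convert h using 1
  simp [quadFormDeriv, Finset.sum_add_distrib, add_mul]

lemma sum_coord_mul_quadFormDeriv (A : Fin n → Fin n → ℝ) (x : En n) :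
    ∑ i, x i * quadFormDeriv A i x = 2 * quadForm A x := by
  have h : ∑ i, ∑ q, A q i * x q * x i = quadForm A x := Finset.sum_comm
  calc ∑ i, x i * quadFormDeriv A i x
      = (∑ i, ∑ q, A i q * x i * x q) + ∑ i, ∑ q, A q i * x q * x i := by
        simp only [quadFormDeriv, Finset.mul_sum, ← Finset.sum_add_distrib]
        exact Finset.sum_congr rfl fun i _ => Finset.sum_congr rfl fun q _ => by ring
    _ = 2 * quadForm A x := by rw [h, two_mul]; rfl

lemma quadForm_mul_quadForm_mul (A B : Fin n → Fin n → ℝ) (x : En n) (y : ℝ) :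
    quadForm A x * quadForm B x * y =
      ∑ p, ∑ r, ∑ q, ∑ t, A p q * B r t * (x p * (x q * (x r * x t)) * y) := by
  simp only [quadForm, Finset.sum_mul_sum, Finset.sum_mul _ _ y]
  refine Finset.sum_congr rfl fun p _ => Finset.sum_congr rfl fun r _ =>
    Finset.sum_congr rfl fun q _ => Finset.sum_congr rfl fun t _ => by ring

lemma integrable_quadForm_mul_quadForm_mul_bubblePow (hn : 3 ≤ n) (A B : Fin n → Fin n → ℝ)
    (m : ℝ) (hm : n + 4 < 2 * m) :
    Integrable (fun x : En n => quadForm A x * quadForm B x * bubblePow n m x) := by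
  simp only [quadForm_mul_quadForm_mul]
  exact integrable_finsetSum _ fun p _ => integrable_finsetSum _ fun r _ =>
    integrable_finsetSum _ fun q _ => integrable_finsetSum _ fun t _ =>
      (integrable_quartic_mul_bubblePow hn p q r t m hm).const_mul _

/-- Wick contraction: an isotropic fourth moment applied to a product of quadratic forms, one of
which is trace-free. -/
lemma integral_quadForm_mul_quadForm_mul_bubblePow (hn : 3 ≤ n) (A B : Fin n → Fin n → ℝ)
    (hA : ∑ p, A p p = 0) (m K : ℝ) (hm : n + 4 < 2 * m)
    (hK : ∀ p q r t : Fin n, ∫ x : En n, x p * (x q * (x r * x t)) * bubblePow n m x =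
      K * ((if q = p then 1 else 0) * (if t = r then 1 else 0) +
          (if r = p then 1 else 0) * (if t = q then 1 else 0) +
          (if t = p then 1 else 0) * (if r = q then 1 else 0))) :
    ∫ x : En n, quadForm A x * quadForm B x * bubblePow n m x =
      K * ∑ p, ∑ q, A p q * (B p q + B q p) := by
  have hi : ∀ p r q t : Fin n, Integrable (fun x : En n =>
      A p q * B r t * (x p * (x q * (x r * x t)) * bubblePow n m x)) := fun p r q t =>
    (integrable_quartic_mul_bubblePow hn p q r t m hm).const_mul _
  simp only [quadForm_mul_quadForm_mul]
  rw [integral_finsetSum _ fun p _ => integrable_finsetSum _ fun r _ =>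
    integrable_finsetSum _ fun q _ => integrable_finsetSum _ fun t _ => hi p r q t]
  rw [Finset.mul_sum, ← sub_eq_zero, ← Finset.sum_sub_distrib]
  have h : ∀ p, (∫ x : En n, ∑ r, ∑ q, ∑ t,
      A p q * B r t * (x p * (x q * (x r * x t)) * bubblePow n m x)) -
        K * ∑ q, A p q * (B p q + B q p) = A p p * (K * ∑ r, B r r) := by
    intro p
    rw [integral_finsetSum _ fun r _ =>
      integrable_finsetSum _ fun q _ => integrable_finsetSum _ fun t _ => hi p r q t]
    have h1 : ∀ r, ∫ x : En n, ∑ q, ∑ t,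
        A p q * B r t * (x p * (x q * (x r * x t)) * bubblePow n m x) =
          K * (A p p * B r r + (if r = p then ∑ q, A p q * B r q else 0) + A p r * B r p) := by
      intro r
      rw [integral_finsetSum _ fun q _ => integrable_finsetSum _ fun t _ => hi p r q t]
      have h2 : ∀ q, ∫ x : En n, ∑ t,
          A p q * B r t * (x p * (x q * (x r * x t)) * bubblePow n m x) =
            K * ((if q = p then A p q * B r r else 0) + (if r = p then A p q * B r q else 0) +
              (if r = q then A p q * B r p else 0)) := by
        intro q
        rw [integral_finsetSum _ fun t _ => hi p r q t]
        simp only [integral_const_mul, hK, mul_add, Finset.sum_add_distrib]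
        simp [mul_comm]
      simp only [h2, ← Finset.mul_sum, Finset.sum_add_distrib]
      by_cases hr : r = p <;> simp [hr]
    simp only [h1, ← Finset.mul_sum, Finset.sum_add_distrib, mul_add]
    simp
    ring
  simp only [h, ← Finset.sum_mul, hA, zero_mul]

lemma sum_quadFormDeriv_mul_quadFormDeriv_mul (A B : Fin n → Fin n → ℝ) (x : En n) (y : ℝ) :
    (∑ i, quadFormDeriv A i x * quadFormDeriv B i x) * y =
      ∑ i, ∑ q, ∑ r, (A i q + A q i) * (B i r + B r i) * (x q * x r * y) := by
  simp only [quadFormDeriv, Finset.sum_mul_sum, Finset.sum_mul _ _ y]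
  refine Finset.sum_congr rfl fun p _ => Finset.sum_congr rfl fun r _ =>
    Finset.sum_congr rfl fun q _ => by ring

lemma integrable_sum_quadFormDeriv_mul_bubblePow (hn : 3 ≤ n) (A B : Fin n → Fin n → ℝ)
    (m : ℝ) (hm : n + 2 < 2 * m) :
    Integrable (fun x : En n =>
      (∑ i, quadFormDeriv A i x * quadFormDeriv B i x) * bubblePow n m x) := by
  simp only [sum_quadFormDeriv_mul_quadFormDeriv_mul]
  exact integrable_finsetSum _ fun i _ => integrable_finsetSum _ fun q _ =>
    integrable_finsetSum _ fun r _ =>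
      (integrable_coord_mul_coord_mul_bubblePow hn q r m hm).const_mul _

lemma integral_sum_quadFormDeriv_mul_bubblePow (hn : 4 ≤ n) (A B : Fin n → Fin n → ℝ) :
    ∫ x : En n, (∑ i, quadFormDeriv A i x * quadFormDeriv B i x) * bubblePow n n x =
      2 * n * (∫ x : En n, bubblePow n n x) * ∑ p, ∑ q, A p q * (B p q + B q p) := by
  have hn' : (4 : ℝ) ≤ n := by exact_mod_cast hn
  have hi : ∀ i q r : Fin n, Integrable (fun x : En n =>
      (A i q + A q i) * (B i r + B r i) * (x q * x r * bubblePow n n x)) := fun i q r =>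
    (integrable_coord_mul_coord_mul_bubblePow (by omega) q r n (by linarith)).const_mul _
  simp only [sum_quadFormDeriv_mul_quadFormDeriv_mul]
  rw [integral_finsetSum _ fun i _ => integrable_finsetSum _ fun q _ =>
    integrable_finsetSum _ fun r _ => hi i q r]
  have h : ∀ i, ∫ x : En n, ∑ q, ∑ r,
      (A i q + A q i) * (B i r + B r i) * (x q * x r * bubblePow n n x) =
        n * (∫ x : En n, bubblePow n n x) *
          ((∑ q, A i q * (B i q + B q i)) + ∑ q, A q i * (B q i + B i q)) := by
    intro i
    rw [integral_finsetSum _ fun q _ => integrable_finsetSum _ fun r _ => hi i q r,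
      ← Finset.sum_add_distrib, Finset.mul_sum]
    refine Finset.sum_congr rfl fun q _ => ?_
    rw [integral_finsetSum _ fun r _ => hi i q r]
    simp only [integral_const_mul, integral_coord_mul_coord_mul_bubblePow_dim hn]
    simp
    ring
  simp only [h]
  rw [← Finset.mul_sum, Finset.sum_add_distrib,
    Finset.sum_comm (f := fun i q => A q i * (B q i + B i q))]
  ring

lemma gradient_apply {F : En n → ℝ} {x : En n} {i : Fin n} {F' : ℝ}
    (hF : DifferentiableAt ℝ F x)
    (h : HasLineDerivAt ℝ F F' x (EuclideanSpace.single i 1)) : gradient F x i = F' := by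
  rw [← h.lineDeriv, hF.lineDeriv_eq_fderiv, hF.hasGradientAt.hasFDerivAt.fderiv,
    InnerProductSpace.toDual_apply_apply]
  exact ((EuclideanSpace.inner_single_right i 1 _).trans (one_mul _)).symm

lemma differentiable_quadForm (A : Fin n → Fin n → ℝ) : Differentiable ℝ (quadForm A) := by
  unfold quadForm
  fun_prop

lemma gradient_quadForm_mul_bubblePow_apply (hn : 3 ≤ n) (A : Fin n → Fin n → ℝ) (κ : ℝ)
    (x : En n) (i : Fin n) :
    gradient (fun y => κ * quadForm A y * bubblePow n (n / 2) y) x i =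
      κ * (quadFormDeriv A i x * bubblePow n (n / 2) x -
        1 / ((n : ℝ) - 2) * (x i * quadForm A x * bubblePow n (n / 2 + 1) x)) := by
  have hn' : (3 : ℝ) ≤ n := by exact_mod_cast hn
  have h1 : HasLineDerivAt ℝ (fun y => κ * quadForm A y) (κ * quadFormDeriv A i x) x
    (EuclideanSpace.single i 1) := HasDerivAt.const_mul _ (hasLineDerivAt_quadForm A i x)
  rw [gradient_apply (((differentiable_quadForm A x).const_mul κ).fun_mul
    (differentiable_bubblePow hn _ x)) (h1.fun_mul (hasLineDerivAt_bubblePow hn _ i x))]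
  have h2 : (n : ℝ) - 2 ≠ 0 := by linarith
  have h3 : (n : ℝ) ≠ 0 := by linarith
  field_simp
  ring

lemma inner_gradient_quadForm_mul_bubblePow (hn : 3 ≤ n) (A B : Fin n → Fin n → ℝ) (κ : ℝ)
    (x : En n) :
    ⟪gradient (fun y => κ * quadForm A y * bubblePow n (n / 2) y) x,
      gradient (fun y => κ * quadForm B y * bubblePow n (n / 2) y) x⟫ =
    κ ^ 2 * (((∑ i, quadFormDeriv A i x * quadFormDeriv B i x) * bubblePow n n x) +
      ((n : ℝ) - 4) / (n - 2) * (quadForm A x * quadForm B x * bubblePow n (n + 1) x) -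
      (n : ℝ) / (n - 2) * (quadForm A x * quadForm B x * bubblePow n (n + 2) x)) := by
  have hn' : (3 : ℝ) ≤ n := by exact_mod_cast hn
  have h2 : (n : ℝ) - 2 ≠ 0 := by linarith
  have e0 := bubblePow_mul hn (n / 2) (n / 2) x
  have e1 := bubblePow_mul hn (n / 2) (n / 2 + 1) x
  have e2 := bubblePow_mul hn (n / 2 + 1) (n / 2 + 1) x
  have e3 := normSq_mul_bubblePow hn (n + 1) x
  rw [add_halves] at e0
  rw [← add_assoc, add_halves] at e1
  rw [show (n : ℝ) / 2 + 1 + (n / 2 + 1) = n + 2 by ring] at e2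
  rw [show (n : ℝ) + 1 + 1 = n + 2 by ring, EuclideanSpace.real_norm_sq_eq] at e3
  have hA := sum_coord_mul_quadFormDeriv A x
  have hB := sum_coord_mul_quadFormDeriv B x
  have hsum : ⟪gradient (fun y => κ * quadForm A y * bubblePow n (n / 2) y) x,
      gradient (fun y => κ * quadForm B y * bubblePow n (n / 2) y) x⟫ =
    κ ^ 2 * ((∑ i, quadFormDeriv A i x * quadFormDeriv B i x) * bubblePow n n x -
      1 / ((n : ℝ) - 2) * bubblePow n (n + 1) x *
        ((∑ i, x i * quadFormDeriv A i x) * quadForm B x +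
          (∑ i, x i * quadFormDeriv B i x) * quadForm A x) +
      (1 / ((n : ℝ) - 2)) ^ 2 * (quadForm A x * quadForm B x) *
        ((∑ i, x i ^ 2) * bubblePow n (n + 2) x)) := by
    rw [← e0, ← e1, ← e2, PiLp.inner_apply]
    simp only [gradient_quadForm_mul_bubblePow_apply hn, Finset.sum_mul, Finset.mul_sum,
      ← Finset.sum_add_distrib, ← Finset.sum_sub_distrib]
    refine Finset.sum_congr rfl fun i _ => ?_
    simp only [RCLike.inner_apply, conj_trivial]
    ring
  rw [hsum, hA, hB, e3]
  field_simp
  ring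

end BubblePow

lemma IsWeyl.sum_apply_self {n : ℕ} {W : Fin n → Fin n → Fin n → Fin n → ℝ} (hW : IsWeyl n W)
    (a b : Fin n) : ∑ p, W a p b p = 0 := by
  rw [← hW.2.2.2.1 a b]
  exact Finset.sum_congr rfl fun p _ => by rw [hW.1 a p b p, hW.2.1 p a b p, neg_neg]

theorem stmt17 (n : ℕ) (hn : 11 ≤ n) (W : Fin n → Fin n → Fin n → Fin n → ℝ)
    (hWeyl : IsWeyl n W) (a b c d : Fin n) :
    (∫ x : En n, ⟪gradient (L0 n W a b) x, gradient (L0 n W c d) x⟫) =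
      ((n : ℝ) + 4) / (36 * ((n : ℝ) + 1)) *
        (∫ x : En n, (1 + ‖x‖ ^ 2 / ((n : ℝ) * ((n : ℝ) - 2))) ^ (-(n : ℝ))) *
        ∑ p, ∑ q, W a p b q * (W c p d q + W c q d p) := by
  have hn' : (11 : ℝ) ≤ n := by exact_mod_cast hn
  have h2 : (n : ℝ) - 2 ≠ 0 := by linarith
  have h3 : 3 ≤ n := by omega
  have h4 : 4 ≤ n := by omega
  have hL : ∀ a b, L0 n W a b = fun y =>
    -(1 / (3 * (n : ℝ))) * quadForm (fun p q => W a p b q) y * bubblePow n (n / 2) y :=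
    fun _ _ => rfl
  have hJ : ∫ x : En n, (1 + ‖x‖ ^ 2 / ((n : ℝ) * ((n : ℝ) - 2))) ^ (-(n : ℝ)) =
    ∫ x : En n, bubblePow n n x := rfl
  have htr := hWeyl.sum_apply_self a b
  rw [hJ, hL, hL]
  simp only [inner_gradient_quadForm_mul_bubblePow h3]
  have i1 := integrable_sum_quadFormDeriv_mul_bubblePow h3 (fun p q => W a p b q)
    (fun p q => W c p d q) n (by linarith)
  have i2 := (integrable_quadForm_mul_quadForm_mul_bubblePow h3 (fun p q => W a p b q)
    (fun p q => W c p d q) (n + 1) (by linarith)).const_mul (((n : ℝ) - 4) / (n - 2))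
  have i3 := (integrable_quadForm_mul_quadForm_mul_bubblePow h3 (fun p q => W a p b q)
    (fun p q => W c p d q) (n + 2) (by linarith)).const_mul ((n : ℝ) / (n - 2))
  rw [integral_const_mul, integral_sub (i1.fun_add i2) i3, integral_add i1 i2,
    integral_const_mul, integral_const_mul,
    integral_sum_quadFormDeriv_mul_bubblePow h4,
    integral_quadForm_mul_quadForm_mul_bubblePow h3 _ _ htr _ _ (by linarith)
      (integral_quartic_mul_bubblePow_dim_add_one h4),
    integral_quadForm_mul_quadForm_mul_bubblePow h3 _ _ htr _ _ (by linarith)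
      (integral_quartic_mul_bubblePow_dim_add_two h4)]
  generalize ∑ p, ∑ q, W a p b q * (W c p d q + W c q d p) = S
  generalize ∫ x : En n, bubblePow n n x = J
  field_simp
  ring
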